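/- arXiv:math-ph/0312049 — 2 statements merged into one kernel-verified Lean document; each statement's English description precedes it below -/
import Mathlib

section
/- Let K be a field, L and F coalgebras over K, x : L → End(F) a linear map with each x(l) right-invariant on F, and X : L → End(T(F)) the unique linear map satisfying X(l)(1) = ε_L(l)·1, X(l)(ι(f)) = ι(x(l)(f)), and X(l)(w₁·w₂) = Σₖ X(l'ₖ)(w₁)·X(l''ₖ)(w₂) where Δ_L(l) = Σₖ l'ₖ ⊗ l''ₖ. Let π : T(L) → End(T(F)) be the unique algebra homomorphism with π(ι_L(l)) = X(l) for all l ∈ L, and let (Δ_{T(L)}, ε_{T(L)}) be the tensor bialgebra structure on T(L). Then the kernel of π is a coideal of the bialgebra T(L): Δ_{T(L)}(ker π) ⊆ ker π ⊗ T(L) + T(L) ⊗ ker π, and ε_{T(L)}(ker π) = 0. -/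
open TensorProduct

/-- The coproduct of the tensor bialgebra structure on `T(L)`: the unique algebra
homomorphism `T(L) → T(L) ⊗ T(L)` extending `(ι ⊗ ι) ∘ Δ`. -/
noncomputable def tensorBialgebraComul (K L : Type) [Field K] [AddCommGroup L] [Module K L]
    [Coalgebra K L] :
    TensorAlgebra K L →ₐ[K] TensorAlgebra K L ⊗[K] TensorAlgebra K L :=
  TensorAlgebra.lift K
    ((TensorProduct.map (TensorAlgebra.ι K) (TensorAlgebra.ι K)) ∘ₗ Coalgebra.comul (R := K))

/-- The counit of the tensor bialgebra structure on `T(L)`: the unique algebra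
homomorphism `T(L) → K` extending `ε`. -/
noncomputable def tensorBialgebraCounit (K L : Type) [Field K] [AddCommGroup L] [Module K L]
    [Coalgebra K L] : TensorAlgebra K L →ₐ[K] K :=
  TensorAlgebra.lift K (Coalgebra.counit (R := K))

section Helpers

/-- Degree `n` part of the tensor algebra. -/
noncomputable abbrev GG (K F : Type) [Field K] [AddCommGroup F] [Module K F] (n : ℕ) :
    Submodule K (TensorAlgebra K F) :=
  LinearMap.range (TensorPower.toTensorAlgebra (R := K) (M := F) (n := n))

lemma GG_mul (K F : Type) [Field K] [AddCommGroup F] [Module K F] {m n : ℕ}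
    {a b : TensorAlgebra K F} (ha : a ∈ GG K F m) (hb : b ∈ GG K F n) :
    a * b ∈ GG K F (m + n) := by
  obtain ⟨s, rfl⟩ := ha
  obtain ⟨t, rfl⟩ := hb
  exact ⟨_, TensorPower.toTensorAlgebra_gMul s t⟩

lemma GG_one (K F : Type) [Field K] [AddCommGroup F] [Module K F] :
    (1 : TensorAlgebra K F) ∈ GG K F 0 :=
  ⟨_, TensorPower.toTensorAlgebra_gOne⟩

lemma GG_iota (K F : Type) [Field K] [AddCommGroup F] [Module K F] (f : F) :
    TensorAlgebra.ι K f ∈ GG K F 1 :=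
  ⟨PiTensorProduct.tprod K (fun _ => f), by
    rw [TensorPower.toTensorAlgebra_tprod]; simp [TensorAlgebra.tprod_apply]⟩

lemma toTA_inj (K F : Type) [Field K] [AddCommGroup F] [Module K F] (n : ℕ) :
    Function.Injective (TensorPower.toTensorAlgebra (R := K) (M := F) (n := n)) := by
  have h : ∀ t : ⨂[K]^n F, TensorAlgebra.toDirectSum (TensorPower.toTensorAlgebra t) =
      DirectSum.of (fun n => ⨂[K]^n F) n t := by
    intro t
    have h1 : TensorAlgebra.ofDirectSum (DirectSum.of (fun n => ⨂[K]^n F) n t) =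
        TensorPower.toTensorAlgebra t :=
      DirectSum.toAddMonoid_of
        (fun _ ↦ LinearMap.toAddMonoidHom TensorPower.toTensorAlgebra) _ _
    rw [← h1, TensorAlgebra.toDirectSum_ofDirectSum]
  intro s t hst
  have := congrArg TensorAlgebra.toDirectSum hst
  rw [h, h] at this
  exact DirectSum.of_injective n this

lemma GG_ind (K F : Type) [Field K] [AddCommGroup F] [Module K F]
    (p : TensorAlgebra K F → Prop) (h0 : p 0) (ha : ∀ a b, p a → p b → p (a + b))
    (hG : ∀ n, ∀ a ∈ GG K F n, p a) (a : TensorAlgebra K F) : p a := by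
  rw [← TensorAlgebra.ofDirectSum_toDirectSum a]
  induction TensorAlgebra.toDirectSum a using DirectSum.induction_on with
  | zero => simpa using h0
  | of n t =>
    apply hG n
    exact ⟨t, (DirectSum.toAddMonoid_of
        (fun _ ↦ LinearMap.toAddMonoidHom TensorPower.toTensorAlgebra) _ _).symm⟩
  | add s t hs ht => rw [map_add]; exact ha _ _ hs ht

lemma mul_inj (K F : Type) [Field K] [AddCommGroup F] [Module K F] (m n : ℕ)
    (z : TensorAlgebra K F ⊗[K] TensorAlgebra K F)
    (hz : z ∈ LinearMap.range (TensorProduct.map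
      (TensorPower.toTensorAlgebra (R := K) (M := F) (n := m))
      (TensorPower.toTensorAlgebra (R := K) (M := F) (n := n))))
    (h : LinearMap.mul' K (TensorAlgebra K F) z = 0) : z = 0 := by
  obtain ⟨y, rfl⟩ := hz
  have key : LinearMap.mul' K (TensorAlgebra K F) ∘ₗ (TensorProduct.map
      (TensorPower.toTensorAlgebra (R := K) (M := F) (n := m))
      (TensorPower.toTensorAlgebra (R := K) (M := F) (n := n))) =
      TensorPower.toTensorAlgebra ∘ₗ
        (TensorPower.mulEquiv (R := K) (M := F) (n := m) (m := n)).toLinearMap := by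
    apply TensorProduct.ext'
    intro s t
    simp only [LinearMap.comp_apply, TensorProduct.map_tmul, LinearMap.mul'_apply]
    exact (TensorPower.toTensorAlgebra_gMul s t).symm
  have h2 := LinearMap.congr_fun key y
  rw [LinearMap.comp_apply, h] at h2
  have h3 : TensorPower.mulEquiv (R := K) (M := F) (n := m) (m := n) y = 0 := by
    apply toTA_inj K F
    rw [map_zero]; exact h2.symm
  rw [LinearEquiv.map_eq_zero_iff] at h3
  rw [h3, map_zero]

lemma endEnd_inj (K V W : Type) [Field K] [AddCommGroup V] [Module K V]
    [AddCommGroup W] [Module K W] (z : Module.End K V ⊗[K] Module.End K W)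
    (h : ∀ a b, Module.endTensorEndAlgHom (R := K) (S := K) (A := K) z (a ⊗ₜ[K] b) = 0) :
    z = 0 := by
  classical
  let B := Module.Basis.ofVectorSpace K (Module.End K W)
  let e := TensorProduct.equivFinsuppOfBasisRight (M := Module.End K V) B
  obtain ⟨c, rfl⟩ := e.symm.surjective z
  suffices hc : c = 0 by rw [hc, map_zero]
  ext i a
  rw [Finsupp.zero_apply, LinearMap.zero_apply]
  rw [← Module.forall_dual_apply_eq_zero_iff K]
  intro φ
  have h1 : c.sum (fun i m => φ (m a) • B i) = 0 := by
    ext b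
    have h2 := h a b
    rw [TensorProduct.equivFinsuppOfBasisRight_symm_apply, Finsupp.sum, map_sum,
      LinearMap.sum_apply] at h2
    have h3 := congrArg (fun y => TensorProduct.lid K W (LinearMap.rTensor W φ y)) h2
    simpa [Finsupp.sum, Module.endTensorEndAlgHom_apply] using h3
  have h4 := linearIndependent_iff'.1 B.linearIndependent c.support (fun i => φ (c i a)) h1 i
  by_cases hi : i ∈ c.support
  · exact h4 hi
  · rw [Finsupp.notMem_support_iff.1 hi]; simp

lemma ker_map (K A B : Type) [Field K] [AddCommGroup A] [Module K A]
    [AddCommGroup B] [Module K B] (p : A →ₗ[K] B) (z : A ⊗[K] A)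
    (hz : TensorProduct.map p p z = 0) :
    z ∈ LinearMap.range (TensorProduct.map (LinearMap.ker p).subtype
          (LinearMap.id : A →ₗ[K] A)) ⊔
        LinearMap.range (TensorProduct.map (LinearMap.id : A →ₗ[K] A)
          (LinearMap.ker p).subtype) := by
  have hex : Function.Exact (LinearMap.ker p).subtype p.rangeRestrict := by
    intro y
    simp [← Subtype.coe_inj]
  have hs : Function.Surjective p.rangeRestrict := p.surjective_rangeRestrict
  have hk := TensorProduct.map_ker hex hs hex hs
  have hi : Function.Injective (TensorProduct.map (LinearMap.range p).subtype
      (LinearMap.range p).subtype) :=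
    TensorProduct.map_injective_of_flat_flat _ _ (Submodule.subtype_injective _)
      (Submodule.subtype_injective _)
  have hz' : z ∈ LinearMap.ker (TensorProduct.map p.rangeRestrict p.rangeRestrict) := by
    rw [LinearMap.mem_ker]
    apply hi
    rw [map_zero, ← LinearMap.comp_apply, ← TensorProduct.map_comp]
    exact hz
  rw [hk, sup_comm] at hz'
  exact hz'

end Helpers

theorem stmt_13 (K L F : Type) [Field K]
    [AddCommGroup L] [Module K L] [Coalgebra K L]
    [AddCommGroup F] [Module K F] [Coalgebra K F]
    (x : L →ₗ[K] Module.End K F)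
    (hx : ∀ l : L, Coalgebra.comul (R := K) ∘ₗ x l =
      LinearMap.rTensor F (x l) ∘ₗ Coalgebra.comul (R := K))
    (X : L →ₗ[K] Module.End K (TensorAlgebra K F))
    (hX1 : ∀ l : L, X l (1 : TensorAlgebra K F) =
      Coalgebra.counit (R := K) l • (1 : TensorAlgebra K F))
    (hX2 : ∀ (l : L) (f : F), X l (TensorAlgebra.ι K f) = TensorAlgebra.ι K (x l f))
    (hX3 : ∀ (l : L) (w₁ w₂ : TensorAlgebra K F), X l (w₁ * w₂) =
      LinearMap.mul' K (TensorAlgebra K F)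
        (TensorProduct.map ((LinearMap.applyₗ w₁) ∘ₗ X) ((LinearMap.applyₗ w₂) ∘ₗ X)
          (Coalgebra.comul (R := K) l)))
    (π : TensorAlgebra K L →ₐ[K] Module.End K (TensorAlgebra K F))
    (hπ : ∀ l : L, π (TensorAlgebra.ι K l) = X l) :
    ∀ w ∈ LinearMap.ker π.toLinearMap,
      tensorBialgebraComul K L w ∈
        LinearMap.range (TensorProduct.map (LinearMap.ker π.toLinearMap).subtype
          (LinearMap.id : TensorAlgebra K L →ₗ[K] TensorAlgebra K L)) ⊔
        LinearMap.range (TensorProduct.map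
          (LinearMap.id : TensorAlgebra K L →ₗ[K] TensorAlgebra K L)
          (LinearMap.ker π.toLinearMap).subtype) ∧
      tensorBialgebraCounit K L w = 0 := by
  -- `X l` preserves degrees
  have hXG : ∀ (n : ℕ) (l : L), ∀ a ∈ GG K F n, X l a ∈ GG K F n := by
    have hlist : ∀ (q : List F) (l : L),
        X l ((q.map (TensorAlgebra.ι K)).prod) ∈ GG K F q.length := by
      intro q
      induction q with
      | nil =>
        intro l
        simp only [List.map_nil, List.prod_nil, List.length_nil]
        rw [hX1]
        exact Submodule.smul_mem _ _ (GG_one K F)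
      | cons f q ih =>
        intro l
        rw [List.map_cons, List.prod_cons, hX3, List.length_cons, add_comm]
        induction (Coalgebra.comul (R := K) l) with
        | zero => simp
        | add s t hs ht => rw [map_add, map_add]; exact Submodule.add_mem _ hs ht
        | tmul s t =>
          simp only [TensorProduct.map_tmul, LinearMap.mul'_apply, LinearMap.comp_apply,
            LinearMap.applyₗ_apply_apply]
          rw [hX2]
          exact GG_mul K F (GG_iota K F _) (ih t)
    rintro n l _ ⟨t, rfl⟩
    induction t using PiTensorProduct.induction_on with
    | smul_tprod r g =>
      rw [map_smul, map_smul, TensorPower.toTensorAlgebra_tprod, TensorAlgebra.tprod_apply]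
      apply Submodule.smul_mem
      have := hlist (List.ofFn g) l
      rw [List.map_ofFn, List.length_ofFn] at this
      exact this
    | add s t hs ht => rw [map_add, map_add]; exact Submodule.add_mem _ hs ht
  have hπG : ∀ (u : TensorAlgebra K L) (n : ℕ), ∀ a ∈ GG K F n, π u a ∈ GG K F n := by
    intro u
    induction u using TensorAlgebra.induction with
    | algebraMap r =>
      intro n a ha
      rw [AlgHom.commutes, Module.algebraMap_end_apply]
      exact Submodule.smul_mem _ _ ha
    | ι l => intro n a ha; rw [hπ]; exact hXG n l a ha
    | mul u v hu hv =>
      intro n a ha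
      rw [map_mul]
      exact hu n _ (hv n a ha)
    | add u v hu hv =>
      intro n a ha
      rw [map_add]
      exact Submodule.add_mem _ (hu n a ha) (hv n a ha)
  let Ψ : TensorAlgebra K L ⊗[K] TensorAlgebra K L →ₐ[K]
      Module.End K (TensorAlgebra K F ⊗[K] TensorAlgebra K F) :=
    (Module.endTensorEndAlgHom (R := K) (S := K) (A := K)).comp (Algebra.TensorProduct.map π π)
  have hΨt : ∀ u v a b, Ψ (u ⊗ₜ v) (a ⊗ₜ b) = π u a ⊗ₜ π v b := by
    intro u v a b
    simp [Ψ, Module.endTensorEndAlgHom_apply]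
  have hmul : ∀ (w : TensorAlgebra K L) (y : TensorAlgebra K F ⊗[K] TensorAlgebra K F),
      LinearMap.mul' K (TensorAlgebra K F) (Ψ (tensorBialgebraComul K L w) y) =
        π w (LinearMap.mul' K (TensorAlgebra K F) y) := by
    intro w
    induction w using TensorAlgebra.induction with
    | algebraMap r =>
      intro y
      rw [AlgHom.commutes, AlgHom.commutes, AlgHom.commutes, Module.algebraMap_end_apply,
        Module.algebraMap_end_apply, map_smul]
    | ι l =>
      intro y
      induction y with
      | zero => simp
      | add s t hs ht => simp only [map_add, hs, ht]
      | tmul a b =>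
        rw [hπ, LinearMap.mul'_apply, hX3, tensorBialgebraComul, TensorAlgebra.lift_ι_apply,
          LinearMap.comp_apply]
        induction (Coalgebra.comul (R := K) l) with
        | zero => simp
        | add s t hs ht => simp only [map_add, LinearMap.add_apply, hs, ht]
        | tmul s t =>
          rw [TensorProduct.map_tmul, hΨt, hπ, hπ]
          rfl
    | mul u v hu hv =>
      intro y
      rw [map_mul, map_mul, map_mul, Module.End.mul_apply, Module.End.mul_apply, hu, hv]
    | add u v hu hv =>
      intro y
      simp only [map_add, LinearMap.add_apply, hu, hv]
  have hcounit : ∀ (w : TensorAlgebra K L),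
      π w 1 = tensorBialgebraCounit K L w • (1 : TensorAlgebra K F) := by
    intro w
    induction w using TensorAlgebra.induction with
    | algebraMap r =>
      rw [AlgHom.commutes, AlgHom.commutes, Module.algebraMap_end_apply]; rfl
    | ι l => rw [hπ, hX1, tensorBialgebraCounit, TensorAlgebra.lift_ι_apply]
    | mul u v hu hv =>
      rw [map_mul, map_mul, Module.End.mul_apply, hv, map_smul, hu, smul_smul, mul_comm]
    | add u v hu hv => rw [map_add, map_add, LinearMap.add_apply, hu, hv, add_smul]
  intro w hw
  have hw0 : π w = 0 := hw
  constructor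
  · apply ker_map
    apply endEnd_inj
    intro a b
    change Ψ (tensorBialgebraComul K L w) (a ⊗ₜ b) = 0
    induction a using GG_ind with
    | h0 => simp
    | ha a a' h1 h2 => rw [TensorProduct.add_tmul, map_add, h1, h2, add_zero]
    | hG m a ha =>
      induction b using GG_ind with
      | h0 => simp
      | ha a a' h1 h2 => rw [TensorProduct.tmul_add, map_add, h1, h2, add_zero]
      | hG n b hb =>
        apply mul_inj K F m n
        · generalize tensorBialgebraComul K L w = z
          induction z with
          | zero => simp
          | add s t hs ht =>
            rw [map_add, LinearMap.add_apply]; exact Submodule.add_mem _ hs ht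
          | tmul u v =>
            rw [hΨt]
            obtain ⟨s, hs⟩ := hπG u m a ha
            obtain ⟨t, ht⟩ := hπG v n b hb
            exact ⟨s ⊗ₜ t, by rw [TensorProduct.map_tmul, hs, ht]⟩
        · rw [hmul, hw0, LinearMap.zero_apply]
  · have h := hcounit w
    rw [hw0, LinearMap.zero_apply] at h
    exact (smul_eq_zero.1 h.symm).resolve_right one_ne_zero
end

section
/- Let K be a field, L a coalgebra over K of countable dimension, and F a coalgebra over K satisfying: for every finite-dimensional subspace Ω ⊆ F* there exists a subspace J ⊆ F of finite codimension with ε_F(J) = 0, Δ_F(J) ⊆ J ⊗ F + F ⊗ J, and ω(J) = 0 for all ω ∈ Ω. Let x : L → End(F) be a linear map with each x(l) right-invariant on F, let X : L → End(T(F)) be the unique linear map satisfying X(l)(1) = ε_L(l)·1, X(l)(ι(f)) = ι(x(l)(f)), and X(l)(w₁·w₂) = Σₖ X(l'ₖ)(w₁)·X(l''ₖ)(w₂) where Δ_L(l) = Σₖ l'ₖ ⊗ l''ₖ, and let π : T(L) → End(T(F)) be the unique algebra homomorphism with π(ι_L(l)) = X(l). Then there exists a sequence (R_n)_{n ∈ ℕ}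 of finite-dimensional subspaces of T(L), each satisfying Δ_{T(L)}(R_n) ⊆ R_n ⊗ T(L) + T(L) ⊗ R_n and ε_{T(L)}(R_n) = 0, such that ker π equals the two-sided ideal of T(L) generated by ⋃_n R_n. -/
open TensorProduct

namespace Stmt14

section lin
variable {K : Type} [Field K]

theorem tensor_dual_inj {V W : Type} [AddCommGroup V] [Module K V] [AddCommGroup W] [Module K W]
    (t : (V →ₗ[K] K) ⊗[K] (W →ₗ[K] K))
    (h : ∀ v w, LinearMap.mul' K K (TensorProduct.map (LinearMap.applyₗ v)
      (LinearMap.applyₗ w) t) = 0) : t = 0 := by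
  classical
  let B := Module.Basis.ofVectorSpace K (W →ₗ[K] K)
  obtain ⟨b, rfl⟩ := TensorProduct.eq_repr_basis_right B t
  have hb : b = 0 := by
    ext i v
    have h1 : (∑ i ∈ b.support, (b i v) • B i) = 0 := by
      ext w
      have := h v w
      simpa [Finsupp.sum] using this
    have h2 := linearIndependent_iff'.1 B.linearIndependent b.support (fun i => b i v) h1
    by_cases hi : i ∈ b.support
    · simpa using h2 i hi
    · simp [Finsupp.notMem_support_iff.1 hi]
  simp [hb]

theorem ker_map_self {W C : Type} [AddCommGroup W] [Module K W] [AddCommGroup C] [Module K C]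
    (f : C →ₗ[K] W) (t : C ⊗[K] C) (h0 : TensorProduct.map f f t = 0) :
    t ∈ LinearMap.range (TensorProduct.map (LinearMap.id : C →ₗ[K] C) (LinearMap.ker f).subtype) ⊔
      LinearMap.range (TensorProduct.map (LinearMap.ker f).subtype (LinearMap.id : C →ₗ[K] C)) := by
  have hinj : Function.Injective (TensorProduct.map (LinearMap.range f).subtype
      (LinearMap.range f).subtype) := by
    apply TensorProduct.map_injective_of_flat_flat <;> exact Subtype.val_injective
  have h1 : TensorProduct.map f.rangeRestrict f.rangeRestrict t = 0 := by
    apply hinj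
    rw [map_zero, ← h0, ← LinearMap.comp_apply, ← TensorProduct.map_comp]
    rfl
  have hex : Function.Exact (LinearMap.ker f).subtype f.rangeRestrict := by
    rw [LinearMap.exact_iff]; simp
  have := TensorProduct.map_ker hex f.surjective_rangeRestrict hex f.surjective_rangeRestrict
  have h2 : t ∈ LinearMap.ker (TensorProduct.map f.rangeRestrict f.rangeRestrict) := h1
  rw [this] at h2
  exact h2

theorem lemA {V C : Type} [AddCommGroup V] [Module K V] [AddCommGroup C] [Module K C]
    (f : C →ₗ[K] (V →ₗ[K] K)) (t : C ⊗[K] C)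
    (h : ∀ v w, LinearMap.mul' K K (TensorProduct.map (LinearMap.applyₗ v ∘ₗ f)
      (LinearMap.applyₗ w ∘ₗ f) t) = 0) :
    t ∈ LinearMap.range (TensorProduct.map (LinearMap.id : C →ₗ[K] C) (LinearMap.ker f).subtype) ⊔
      LinearMap.range (TensorProduct.map (LinearMap.ker f).subtype (LinearMap.id : C →ₗ[K] C)) := by
  have h0 : TensorProduct.map f f t = 0 := by
    apply tensor_dual_inj
    intro v w
    have := h v w
    rw [TensorProduct.map_comp] at this
    exact this
  exact ker_map_self f t h0

/-- `C` is a subcoalgebra for the "coproduct" `D`. -/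
def IsSub {A : Type} [AddCommGroup A] [Module K A] (D : A →ₗ[K] A ⊗[K] A) (C : Submodule K A) :
    Prop := ∀ a ∈ C, D a ∈ Submodule.map₂ (TensorProduct.mk K A A) C C

theorem isSub_sup {A : Type} [AddCommGroup A] [Module K A] {D : A →ₗ[K] A ⊗[K] A}
    {C C' : Submodule K A} (h : IsSub D C) (h' : IsSub D C') : IsSub D (C ⊔ C') := by
  have : C ⊔ C' ≤ (Submodule.map₂ (TensorProduct.mk K A A) (C ⊔ C') (C ⊔ C')).comap D := by
    apply sup_le
    · intro a ha
      exact Submodule.map₂_le_map₂ le_sup_left le_sup_left (h a ha)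
    · intro a ha
      exact Submodule.map₂_le_map₂ le_sup_right le_sup_right (h' a ha)
  exact this

theorem fund1 {L : Type} [AddCommGroup L] [Module K L] [Coalgebra K L] (l : L) :
    ∃ N : Submodule K L, FiniteDimensional K N ∧ l ∈ N ∧
      ∀ a ∈ N, Coalgebra.comul (R := K) a ∈ Submodule.map₂ (TensorProduct.mk K L L) ⊤ N := by
  classical
  let B := Module.Basis.ofVectorSpace K L
  obtain ⟨c, hc⟩ := TensorProduct.eq_repr_basis_left B (Coalgebra.comul (R := K) l)
  refine ⟨Submodule.span K (c '' c.support), ?_, ?_, ?_⟩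
  · exact FiniteDimensional.span_of_finite K (c.support.finite_toSet.image _)
  · have h := Coalgebra.rTensor_counit_comul (R := K) l
    rw [← hc] at h
    have h2 := congrArg (TensorProduct.lid K L) h
    simp [Finsupp.sum] at h2
    rw [← h2]
    exact Submodule.sum_mem _ fun i hi => Submodule.smul_mem _ _
      (Submodule.subset_span ⟨i, hi, rfl⟩)
  · have key : ∀ i, Coalgebra.comul (R := K) (c i) = ∑ j ∈ c.support,
        (TensorProduct.lid K L (LinearMap.rTensor L (B.coord i) (Coalgebra.comul (R := K) (B j))))
          ⊗ₜ[K] c j := by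
      intro i
      have h := Coalgebra.coassoc_apply (R := K) l
      rw [← hc] at h
      simp only [Finsupp.sum, map_sum, LinearMap.rTensor_tmul, LinearMap.lTensor_tmul] at h
      have h2 := congrArg (fun z => TensorProduct.lid K _ (LinearMap.rTensor (L ⊗[K] L) (B.coord i) z)) h
      simp only [map_sum, LinearMap.rTensor_tmul, TensorProduct.lid_tmul] at h2
      have e : ∑ x ∈ c.support, (B.coord i) (B x) • Coalgebra.comul (R := K) (c x)
          = Coalgebra.comul (R := K) (c i) := by
        simp only [Module.Basis.coord_apply, Module.Basis.repr_self, Finsupp.single_apply,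
          ite_smul, one_smul, zero_smul]
        rw [Finset.sum_ite_eq']
        split_ifs with hi
        · rfl
        · simp [Finsupp.notMem_support_iff.1 hi]
      rw [← e, ← h2]
      refine Finset.sum_congr rfl fun j _ => ?_
      generalize Coalgebra.comul (R := K) (B j) = t
      induction t with
      | zero => simp
      | add a b ha hb => simp only [map_add, TensorProduct.add_tmul, ha, hb]
      | tmul a b => simp [TensorProduct.smul_tmul']
    have : Submodule.span K (c '' c.support) ≤ (Submodule.map₂ (TensorProduct.mk K L L) ⊤
        (Submodule.span K (c '' c.support))).comap (Coalgebra.comul (R := K)) := by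
      rw [Submodule.span_le]
      rintro _ ⟨i, hi, rfl⟩
      rw [SetLike.mem_coe, Submodule.mem_comap, key]
      exact Submodule.sum_mem _ fun j hj => Submodule.apply_mem_map₂ _ Submodule.mem_top
        (Submodule.subset_span ⟨j, hj, rfl⟩)
    exact this

theorem fund2 {L : Type} [AddCommGroup L] [Module K L] [Coalgebra K L] (l : L) :
    ∃ N : Submodule K L, FiniteDimensional K N ∧ l ∈ N ∧
      IsSub (Coalgebra.comul (R := K)) N := by
  classical
  obtain ⟨N, hN, hl, hco⟩ := fund1 (K := K) l
  let b := Module.finBasis K N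
  have hφ : ∀ i, ∃ φ : L →ₗ[K] K, φ ∘ₗ N.subtype = b.coord i := fun i =>
    LinearMap.exists_extend _
  choose φ hφ using hφ
  have hφb : ∀ i j, φ i (b j : L) = if i = j then 1 else 0 := by
    intro i j
    have := LinearMap.congr_fun (hφ i) (b j)
    simp only [LinearMap.comp_apply, Submodule.subtype_apply, Module.Basis.coord_apply,
      Module.Basis.repr_self, Finsupp.single_apply] at this
    rw [this]; simp only [eq_comm]
  let c : Fin (Module.finrank K N) → L →ₗ[K] L := fun i =>
    (TensorProduct.rid K L).toLinearMap ∘ₗ LinearMap.lTensor L (φ i) ∘ₗ Coalgebra.comul (R := K)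
  have hc : ∀ a ∈ N, Coalgebra.comul (R := K) a = ∑ i, c i a ⊗ₜ[K] (b i : L) := by
    have gen : ∀ t ∈ Submodule.map₂ (TensorProduct.mk K L L) ⊤ N,
        t = ∑ i, (TensorProduct.rid K L (LinearMap.lTensor L (φ i) t)) ⊗ₜ[K] (b i : L) := by
      let G : L ⊗[K] L →ₗ[K] L ⊗[K] L := ∑ i, ((TensorProduct.mk K L L).flip (b i : L)) ∘ₗ
        (TensorProduct.rid K L).toLinearMap ∘ₗ LinearMap.lTensor L (φ i)
      have : Submodule.map₂ (TensorProduct.mk K L L) ⊤ N ≤ LinearMap.eqLocus LinearMap.id G := by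
        rw [Submodule.map₂_le]
        intro m _ n hn
        have h1 : n = ∑ i, φ i n • (b i : L) := by
          have h2 := b.sum_repr ⟨n, hn⟩
          have h3 := congrArg N.subtype h2
          simp only [map_sum, map_smul, Submodule.subtype_apply] at h3
          rw [← h3]
          refine (Finset.sum_congr rfl fun i _ => ?_)
          have := LinearMap.congr_fun (hφ i) ⟨n, hn⟩
          simp only [LinearMap.comp_apply, Submodule.subtype_apply,
            Module.Basis.coord_apply] at this
          rw [h3, this]
        simp only [LinearMap.mem_eqLocus, G, LinearMap.sum_apply]
        simp only [LinearMap.id_apply, TensorProduct.mk_apply, LinearMap.comp_apply,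
          LinearMap.lTensor_tmul, LinearEquiv.coe_coe, TensorProduct.rid_tmul,
          LinearMap.flip_apply, TensorProduct.smul_tmul, ← TensorProduct.tmul_sum]
        rw [← h1]
      intro t ht
      have := this ht
      simpa [G, LinearMap.mem_eqLocus] using this
    intro a ha
    exact gen _ (hco a ha)
  have hcc : ∀ i j, Coalgebra.comul (R := K) (c i (b j)) = ∑ k, c k (b j) ⊗ₜ[K] c i (b k) := by
    intro i j
    have h := Coalgebra.coassoc_apply (R := K) (b j : L)
    rw [hc _ (b j).2] at h
    simp only [map_sum, LinearMap.rTensor_tmul, LinearMap.lTensor_tmul] at h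
    have h2 := congrArg (fun z => LinearMap.lTensor L ((TensorProduct.rid K L).toLinearMap ∘ₗ
      LinearMap.lTensor L (φ i)) z) h
    simp only [map_sum, LinearMap.lTensor_tmul] at h2
    have e : ∀ (t : L ⊗[K] L) (k), (LinearMap.lTensor L ((TensorProduct.rid K L).toLinearMap ∘ₗ
        LinearMap.lTensor L (φ i))) (TensorProduct.assoc K L L L (t ⊗ₜ[K] (b k : L)))
        = if i = k then t else 0 := by
      intro t k
      rw [← one_smul K t, ← zero_smul K t, ← ite_smul, ← hφb, one_smul]
      induction t with
      | zero => simp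
      | add x y hx hy => simp only [map_add, TensorProduct.add_tmul, hx, hy, smul_add]
      | tmul x y => simp
    simp only [e, Finset.sum_ite_eq, Finset.mem_univ, if_true] at h2
    exact h2
  refine ⟨Submodule.span K (Set.range fun p : Fin (Module.finrank K N) × Fin (Module.finrank K N) =>
    c p.1 (b p.2)), FiniteDimensional.span_of_finite K (Set.finite_range _), ?_, ?_⟩
  · have hle : N ≤ Submodule.span K (Set.range fun p : Fin (Module.finrank K N) ×
        Fin (Module.finrank K N) => c p.1 (b p.2)) := by
      have hb : Submodule.span K (Set.range fun j => (b j : L)) = N := by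
        have := congrArg (Submodule.map N.subtype) b.span_eq
        rw [Submodule.map_span, Submodule.map_top, Submodule.range_subtype, ← Set.range_comp] at this
        exact this
      conv_lhs => rw [← hb]
      rw [Submodule.span_le]
      rintro _ ⟨j, rfl⟩
      have h := Coalgebra.lTensor_counit_comul (R := K) (b j : L)
      rw [hc _ (b j).2] at h
      have h2 := congrArg (TensorProduct.rid K L) h
      simp only [map_sum, LinearMap.lTensor_tmul, TensorProduct.rid_tmul, one_smul] at h2
      change (b j : L) ∈ _
      rw [← h2]
      exact Submodule.sum_mem _ fun i _ => Submodule.smul_mem _ _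
        (Submodule.subset_span ⟨(i, j), rfl⟩)
    exact hle hl
  · set S := Submodule.span K (Set.range fun p : Fin (Module.finrank K N) ×
      Fin (Module.finrank K N) => c p.1 (b p.2)) with hS
    have hle : S ≤ Submodule.comap (Coalgebra.comul (R := K))
        (Submodule.map₂ (TensorProduct.mk K L L) S S) := by
      conv_lhs => rw [hS]
      rw [Submodule.span_le]
      rintro _ ⟨⟨i, j⟩, rfl⟩
      rw [SetLike.mem_coe, Submodule.mem_comap, hcc]
      exact Submodule.sum_mem _ fun k _ => Submodule.apply_mem_map₂ _
        (Submodule.subset_span ⟨(k, j), rfl⟩) (Submodule.subset_span ⟨(i, k), rfl⟩)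
    exact hle

end lin

section TA
variable {K : Type} [Field K] {L : Type} [AddCommGroup L] [Module K L] [Coalgebra K L]

theorem isSub_mul {A : Type} [Ring A] [Algebra K A] (D : A →ₐ[K] A ⊗[K] A)
    {C C' : Submodule K A} (h : IsSub D.toLinearMap C) (h' : IsSub D.toLinearMap C') :
    IsSub D.toLinearMap (C * C') := by
  have aux : Submodule.map₂ (TensorProduct.mk K A A) C C *
      Submodule.map₂ (TensorProduct.mk K A A) C' C' ≤
      Submodule.map₂ (TensorProduct.mk K A A) (C * C') (C * C') := by
    rw [Submodule.mul_le]
    intro s hs t ht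
    have h1 : Submodule.map₂ (TensorProduct.mk K A A) C C ≤
        (Submodule.map₂ (TensorProduct.mk K A A) (C * C') (C * C')).comap
          (LinearMap.mulRight K t) := by
      rw [Submodule.map₂_le]
      intro m hm n hn
      have h2 : Submodule.map₂ (TensorProduct.mk K A A) C' C' ≤
          (Submodule.map₂ (TensorProduct.mk K A A) (C * C') (C * C')).comap
            (LinearMap.mulLeft K (m ⊗ₜ[K] n)) := by
        rw [Submodule.map₂_le]
        intro m' hm' n' hn'
        rw [Submodule.mem_comap, LinearMap.mulLeft_apply, TensorProduct.mk_apply,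
          Algebra.TensorProduct.tmul_mul_tmul]
        exact Submodule.apply_mem_map₂ _ (Submodule.mul_mem_mul hm hm')
          (Submodule.mul_mem_mul hn hn')
      exact h2 ht
    exact h1 hs
  have : C * C' ≤ (Submodule.map₂ (TensorProduct.mk K A A) (C * C') (C * C')).comap
      D.toLinearMap := by
    rw [Submodule.mul_le]
    intro m hm n hn
    rw [Submodule.mem_comap, AlgHom.toLinearMap_apply, map_mul]
    exact aux (Submodule.mul_mem_mul (h m hm) (h' n hn))
  exact this

theorem exists_sub (a : TensorAlgebra K L) : ∃ C : Submodule K (TensorAlgebra K L),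
    FiniteDimensional K C ∧ a ∈ C ∧ IsSub (tensorBialgebraComul K L).toLinearMap C := by
  induction a using TensorAlgebra.induction with
  | algebraMap r =>
    refine ⟨Submodule.span K {1}, inferInstance, ?_, ?_⟩
    · rw [Submodule.mem_span_singleton]
      exact ⟨r, (Algebra.algebraMap_eq_smul_one r).symm⟩
    · intro a ha
      obtain ⟨r, rfl⟩ := Submodule.mem_span_singleton.1 ha
      rw [map_smul]
      apply Submodule.smul_mem
      change tensorBialgebraComul K L 1 ∈ _
      rw [map_one]
      exact Submodule.apply_mem_map₂ _ (Submodule.mem_span_singleton_self _)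
        (Submodule.mem_span_singleton_self _)
  | ι l =>
    obtain ⟨N, hN, hl, hs⟩ := fund2 (K := K) l
    refine ⟨N.map (TensorAlgebra.ι K), inferInstance, ⟨l, hl, rfl⟩, ?_⟩
    rintro _ ⟨n, hn, rfl⟩
    have h := hs n hn
    have e : (tensorBialgebraComul K L).toLinearMap (TensorAlgebra.ι K n) =
      TensorProduct.map (TensorAlgebra.ι K) (TensorAlgebra.ι K) (Coalgebra.comul (R := K) n) := by
      simp [tensorBialgebraComul]
    rw [e]
    have : Submodule.map₂ (TensorProduct.mk K L L) N N ≤ (Submodule.map₂ (TensorProduct.mk K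
        (TensorAlgebra K L) (TensorAlgebra K L)) (N.map (TensorAlgebra.ι K))
          (N.map (TensorAlgebra.ι K))).comap
        (TensorProduct.map (TensorAlgebra.ι K) (TensorAlgebra.ι K)) := by
      rw [Submodule.map₂_le]
      intro m hm n hn
      exact Submodule.apply_mem_map₂ _ (Submodule.mem_map_of_mem hm) (Submodule.mem_map_of_mem hn)
    exact this h
  | mul a b ha hb =>
    obtain ⟨C, h1, h2, h3⟩ := ha
    obtain ⟨C', h1', h2', h3'⟩ := hb
    refine ⟨C * C', ?_, Submodule.mul_mem_mul h2 h2', isSub_mul _ h3 h3'⟩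
    exact Module.Finite.iff_fg.2 ((Module.Finite.iff_fg.1 h1).mul (Module.Finite.iff_fg.1 h1'))
  | add a b ha hb =>
    obtain ⟨C, h1, h2, h3⟩ := ha
    obtain ⟨C', h1', h2', h3'⟩ := hb
    exact ⟨C ⊔ C', inferInstance, Submodule.add_mem_sup h2 h2', isSub_sup h3 h3'⟩

theorem exists_seq (hL : ∃ s : Set L, s.Countable ∧ Submodule.span K s = ⊤) :
    ∃ C : ℕ → Submodule K (TensorAlgebra K L), (∀ n, FiniteDimensional K (C n)) ∧
      (∀ n, IsSub (tensorBialgebraComul K L).toLinearMap (C n)) ∧ ∀ a, ∃ n, a ∈ C n := by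
  obtain ⟨s, hs, hspan⟩ := hL
  obtain ⟨b, hbs, hb, hli⟩ := exists_linearIndependent K s
  have : Countable b := (hs.mono hbs).to_subtype
  let B : Module.Basis b K L := Module.Basis.mk hli (by
    rw [Subtype.range_coe, hb, hspan])
  let T := B.tensorAlgebra
  have : Countable (FreeMonoid b) := inferInstanceAs (Countable (List b))
  obtain ⟨e, he⟩ := exists_surjective_nat (FreeMonoid b)
  choose D h1 h2 h3 using fun n => exists_sub (T (e n))
  obtain ⟨C, hC0, hC⟩ : ∃ C : ℕ → Submodule K (TensorAlgebra K L),
      C 0 = D 0 ∧ ∀ n, C (n + 1) = C n ⊔ D (n + 1) :=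
    ⟨fun n => Nat.rec (D 0) (fun k P => P ⊔ D (k + 1)) n, rfl, fun n => rfl⟩
  have hmono : Monotone C := monotone_nat_of_le_succ fun n => by rw [hC]; exact le_sup_left
  have hD : ∀ n, D n ≤ C n := by
    intro n
    cases n with
    | zero => exact hC0.ge
    | succ n => rw [hC]; exact le_sup_right
  refine ⟨C, ?_, ?_, ?_⟩
  · intro n
    induction n with
    | zero => rw [hC0]; exact h1 0
    | succ n ih => 
      have h4 : FiniteDimensional K (D (n + 1)) := h1 (n + 1)
      have h5 : FiniteDimensional K (C n) := ih
      rw [hC]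
      exact Submodule.finiteDimensional_sup (C n) (D (n + 1))
  · intro n
    induction n with
    | zero => rw [hC0]; exact h3 0
    | succ n ih => rw [hC]; exact isSub_sup ih (h3 _)
  · intro a
    have ha : a ∈ Submodule.span K (Set.range T) := by rw [T.span_eq]; trivial
    induction ha using Submodule.span_induction with
    | mem x hx =>
      obtain ⟨i, rfl⟩ := hx
      obtain ⟨n, rfl⟩ := he i
      exact ⟨n, hD n (h2 n)⟩
    | zero => exact ⟨0, Submodule.zero_mem _⟩
    | add x y _ _ hx hy =>
      obtain ⟨n, hn⟩ := hx
      obtain ⟨m, hm⟩ := hy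
      exact ⟨max n m, Submodule.add_mem _ (hmono (le_max_left _ _) hn)
        (hmono (le_max_right _ _) hm)⟩
    | smul r x _ hx =>
      obtain ⟨n, hn⟩ := hx
      exact ⟨n, Submodule.smul_mem _ _ hn⟩

theorem counit_comul (w : TensorAlgebra K L) :
    TensorProduct.lid K _ (LinearMap.rTensor (TensorAlgebra K L)
      (tensorBialgebraCounit K L).toLinearMap (tensorBialgebraComul K L w)) = w := by
  have : ((Algebra.TensorProduct.lid K (TensorAlgebra K L)).toAlgHom.comp
      (Algebra.TensorProduct.map (tensorBialgebraCounit K L) (AlgHom.id K _))).comp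
      (tensorBialgebraComul K L) = AlgHom.id K _ := by
    ext l
    have h := Coalgebra.rTensor_counit_comul (R := K) l
    have h2 := congrArg (fun z => TensorAlgebra.ι K (TensorProduct.lid K L z)) h
    simp only [TensorProduct.lid_tmul, one_smul] at h2
    simp only [tensorBialgebraComul, LinearMap.comp_apply, AlgHom.toLinearMap_apply,
      AlgHom.comp_apply, TensorAlgebra.lift_ι_apply, AlgHom.id_apply]
    refine Eq.trans ?_ h2
    generalize Coalgebra.comul (R := K) l = t
    induction t with
    | zero => simp
    | add a b ha hb => simp only [map_add, ha, hb]
    | tmul a b => simp [tensorBialgebraCounit]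
  exact DFunLike.congr_fun this w

variable {F : Type} [AddCommGroup F] [Module K F] [Coalgebra K F]

theorem X_inv (x : L →ₗ[K] Module.End K F)
    (hx : ∀ l : L, Coalgebra.comul (R := K) ∘ₗ x l =
      LinearMap.rTensor F (x l) ∘ₗ Coalgebra.comul (R := K))
    (X : L →ₗ[K] Module.End K (TensorAlgebra K F))
    (hX1 : ∀ l : L, X l (1 : TensorAlgebra K F) =
      Coalgebra.counit (R := K) l • (1 : TensorAlgebra K F))
    (hX2 : ∀ (l : L) (f : F), X l (TensorAlgebra.ι K f) = TensorAlgebra.ι K (x l f))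
    (hX3 : ∀ (l : L) (w₁ w₂ : TensorAlgebra K F), X l (w₁ * w₂) =
      LinearMap.mul' K (TensorAlgebra K F)
        (TensorProduct.map ((LinearMap.applyₗ w₁) ∘ₗ X) ((LinearMap.applyₗ w₂) ∘ₗ X)
          (Coalgebra.comul (R := K) l))) (w : TensorAlgebra K F) (l : L) :
    tensorBialgebraComul K F (X l w) =
      LinearMap.rTensor (TensorAlgebra K F) (X l) (tensorBialgebraComul K F w) := by
  induction w using TensorAlgebra.induction generalizing l with
  | algebraMap r =>
    rw [Algebra.algebraMap_eq_smul_one, map_smul, map_smul, map_smul, map_smul, hX1, map_smul,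
      map_one, Algebra.TensorProduct.one_def, LinearMap.rTensor_tmul, hX1, TensorProduct.smul_tmul']
  | ι f =>
    rw [hX2]
    have h := LinearMap.congr_fun (hx l) f
    simp only [LinearMap.comp_apply] at h
    simp only [tensorBialgebraComul, TensorAlgebra.lift_ι_apply, LinearMap.comp_apply, h]
    generalize Coalgebra.comul (R := K) f = t
    induction t with
    | zero => simp
    | add a b ha hb => simp only [map_add, ha, hb]
    | tmul a b => simp [hX2]
  | add a b ha hb => simp only [map_add, ha, hb]
  | mul a b ha hb =>
    let rX : L →ₗ[K] Module.End K (TensorAlgebra K F ⊗[K] TensorAlgebra K F) :=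
      LinearMap.rTensorHom (TensorAlgebra K F) ∘ₗ X
    have hrX : ∀ l, rX l = LinearMap.rTensor (TensorAlgebra K F) (X l) := fun l => rfl
    have e1 : ∀ s1 s2, LinearMap.rTensor (TensorAlgebra K F) (X l) (s1 * s2) =
        LinearMap.mul' K _ (TensorProduct.map ((LinearMap.applyₗ s1) ∘ₗ rX)
          ((LinearMap.applyₗ s2) ∘ₗ rX) (Coalgebra.comul (R := K) l)) := by
      intro s1 s2
      induction s1 with
      | zero => simp
      | add p q hp hq =>
        rw [add_mul, map_add, hp, hq, map_add, LinearMap.add_comp, TensorProduct.map_add_left]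
        simp
      | tmul p q =>
        induction s2 with
        | zero => simp
        | add p q hp hq =>
          rw [mul_add, map_add, hp, hq, map_add, LinearMap.add_comp, TensorProduct.map_add_right]
          simp
        | tmul p' q' =>
          rw [Algebra.TensorProduct.tmul_mul_tmul, LinearMap.rTensor_tmul, hX3]
          generalize Coalgebra.comul (R := K) l = t
          induction t with
          | zero => simp
          | add a b ha hb => simp only [map_add, TensorProduct.add_tmul, ha, hb]
          | tmul a b => simp [hrX]
    rw [map_mul (tensorBialgebraComul K F) a b, e1, hX3]
    generalize Coalgebra.comul (R := K) l = t
    induction t with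
    | zero => simp
    | add p q hp hq => simp only [map_add, hp, hq]
    | tmul p q => simp [hrX, ha, hb]

theorem π_mul (X : L →ₗ[K] Module.End K (TensorAlgebra K F))
    (hX3 : ∀ (l : L) (w₁ w₂ : TensorAlgebra K F), X l (w₁ * w₂) =
      LinearMap.mul' K (TensorAlgebra K F)
        (TensorProduct.map ((LinearMap.applyₗ w₁) ∘ₗ X) ((LinearMap.applyₗ w₂) ∘ₗ X)
          (Coalgebra.comul (R := K) l)))
    (π : TensorAlgebra K L →ₐ[K] Module.End K (TensorAlgebra K F))
    (hπ : ∀ l : L, π (TensorAlgebra.ι K l) = X l) (a : TensorAlgebra K L)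
    (w₁ w₂ : TensorAlgebra K F) :
    π a (w₁ * w₂) = LinearMap.mul' K (TensorAlgebra K F)
        (TensorProduct.map ((LinearMap.applyₗ w₁) ∘ₗ π.toLinearMap)
          ((LinearMap.applyₗ w₂) ∘ₗ π.toLinearMap) (tensorBialgebraComul K L a)) := by
  induction a using TensorAlgebra.induction generalizing w₁ w₂ with
  | algebraMap r =>
    rw [Algebra.algebraMap_eq_smul_one]
    simp [Algebra.TensorProduct.one_def]
  | ι l =>
    rw [hπ, hX3]
    simp only [tensorBialgebraComul, TensorAlgebra.lift_ι_apply, LinearMap.comp_apply]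
    generalize Coalgebra.comul (R := K) l = t
    induction t with
    | zero => simp
    | add a b ha hb => simp only [map_add, ha, hb]
    | tmul a b => simp [hπ]
  | add a b ha hb => simp only [map_add, LinearMap.add_apply, ha, hb]
  | mul a b ha hb =>
    rw [map_mul π a b, map_mul (tensorBialgebraComul K L) a b, Module.End.mul_apply, hb]
    generalize tensorBialgebraComul K L b = t
    induction t with
    | zero => simp
    | add p q hp hq => simp only [map_add, mul_add, hp, hq]
    | tmul p q =>
      simp only [TensorProduct.map_tmul, LinearMap.mul'_apply]
      rw [ha]
      generalize tensorBialgebraComul K L a = s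
      induction s with
      | zero => simp
      | add p q hp hq => simp only [map_add, add_mul, hp, hq]
      | tmul p q => simp

end TA

end Stmt14

theorem stmt_14 (K L F : Type) [Field K]
    [AddCommGroup L] [Module K L] [Coalgebra K L]
    [AddCommGroup F] [Module K F] [Coalgebra K F]
    -- `L` has countable dimension
    (hL : ∃ s : Set L, s.Countable ∧ Submodule.span K s = ⊤)
    -- `F` is strongly regular: every finite-dimensional space of forms is annihilated by a
    -- coideal of finite codimension
    (hF : ∀ Ω : Submodule K (F →ₗ[K] K), FiniteDimensional K Ω →
      ∃ J : Submodule K F, FiniteDimensional K (F ⧸ J) ∧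
        (∀ f ∈ J, Coalgebra.counit (R := K) f = 0) ∧
        (∀ f ∈ J, Coalgebra.comul (R := K) f ∈
          LinearMap.range (TensorProduct.map J.subtype (LinearMap.id : F →ₗ[K] F)) ⊔
          LinearMap.range (TensorProduct.map (LinearMap.id : F →ₗ[K] F) J.subtype)) ∧
        (∀ ω ∈ Ω, ∀ f ∈ J, ω f = 0))
    (x : L →ₗ[K] Module.End K F)
    (hx : ∀ l : L, Coalgebra.comul (R := K) ∘ₗ x l =
      LinearMap.rTensor F (x l) ∘ₗ Coalgebra.comul (R := K))
    (X : L →ₗ[K] Module.End K (TensorAlgebra K F))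
    (hX1 : ∀ l : L, X l (1 : TensorAlgebra K F) =
      Coalgebra.counit (R := K) l • (1 : TensorAlgebra K F))
    (hX2 : ∀ (l : L) (f : F), X l (TensorAlgebra.ι K f) = TensorAlgebra.ι K (x l f))
    (hX3 : ∀ (l : L) (w₁ w₂ : TensorAlgebra K F), X l (w₁ * w₂) =
      LinearMap.mul' K (TensorAlgebra K F)
        (TensorProduct.map ((LinearMap.applyₗ w₁) ∘ₗ X) ((LinearMap.applyₗ w₂) ∘ₗ X)
          (Coalgebra.comul (R := K) l)))
    (π : TensorAlgebra K L →ₐ[K] Module.End K (TensorAlgebra K F))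
    (hπ : ∀ l : L, π (TensorAlgebra.ι K l) = X l) :
    ∃ R : ℕ → Submodule K (TensorAlgebra K L),
      (∀ n, FiniteDimensional K (R n)) ∧
      (∀ n, ∀ w ∈ R n,
        tensorBialgebraComul K L w ∈
          LinearMap.range (TensorProduct.map (R n).subtype
            (LinearMap.id : TensorAlgebra K L →ₗ[K] TensorAlgebra K L)) ⊔
          LinearMap.range (TensorProduct.map
            (LinearMap.id : TensorAlgebra K L →ₗ[K] TensorAlgebra K L) (R n).subtype) ∧
        tensorBialgebraCounit K L w = 0) ∧
      LinearMap.ker π.toLinearMap =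
        Submodule.span K {y : TensorAlgebra K L |
          ∃ a b r : TensorAlgebra K L, (∃ n, r ∈ R n) ∧ y = a * r * b} := by
  classical
  have hinv : ∀ a w, tensorBialgebraComul K F (π a w) =
      LinearMap.rTensor (TensorAlgebra K F) (π a) (tensorBialgebraComul K F w) := by
    intro a
    induction a using TensorAlgebra.induction with
    | algebraMap r =>
      intro w
      rw [Algebra.algebraMap_eq_smul_one]
      simp [Module.End.one_eq_id]
    | ι l => intro w; rw [hπ]; exact Stmt14.X_inv x hx X hX1 hX2 hX3 w l
    | add a b ha hb =>
      intro w
      simp only [map_add, LinearMap.add_apply, ha, hb, LinearMap.rTensor_add]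
    | mul a b ha hb =>
      intro w
      rw [map_mul π a b, Module.End.mul_apply, ha, hb, LinearMap.rTensor_mul,
        Module.End.mul_apply]
  have hcounit : ∀ a, π a 1 = tensorBialgebraCounit K L a • (1 : TensorAlgebra K F) := by
    intro a
    induction a using TensorAlgebra.induction with
    | algebraMap r => rw [Algebra.algebraMap_eq_smul_one]; simp
    | ι l => rw [hπ, hX1]; simp [tensorBialgebraCounit]
    | add a b ha hb => simp only [map_add, LinearMap.add_apply, ha, hb, add_smul]
    | mul a b ha hb =>
      rw [map_mul π a b, Module.End.mul_apply, hb, map_smul, ha, smul_smul,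
        map_mul (tensorBialgebraCounit K L) a b, mul_comm]
  let Ψ : TensorAlgebra K L →ₗ[K] (TensorAlgebra K F →ₗ[K] K) :=
    LinearMap.llcomp K (TensorAlgebra K F) (TensorAlgebra K F) K
      (tensorBialgebraCounit K F).toLinearMap ∘ₗ π.toLinearMap
  have hΨ : ∀ a w, Ψ a w = tensorBialgebraCounit K F (π a w) := fun a w => rfl
  have hker : ∀ a, Ψ a = 0 → π a = 0 := by
    intro a ha
    ext w
    have h1 := Stmt14.counit_comul (π a w)
    rw [hinv, ← LinearMap.comp_apply, ← LinearMap.rTensor_comp] at h1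
    have h2 : (tensorBialgebraCounit K F).toLinearMap ∘ₗ π a = 0 := ha
    rw [h2] at h1
    rw [← h1]
    simp
  obtain ⟨C, hC1, hC2, hC3⟩ := Stmt14.exists_seq (K := K) hL
  refine ⟨fun n => LinearMap.ker π.toLinearMap ⊓ C n, ?_, ?_, ?_⟩
  · intro n
    have := hC1 n
    exact Submodule.finiteDimensional_inf_right _ _
  · rintro n w ⟨hw, hwC⟩
    have hw0 : π w = 0 := hw
    constructor
    · have h1 := hC2 n w hwC
      have h2 : Submodule.map₂ (TensorProduct.mk K (TensorAlgebra K L) (TensorAlgebra K L))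
          (C n) (C n) ≤ LinearMap.range (TensorProduct.map (C n).subtype (C n).subtype) := by
        rw [Submodule.map₂_le]
        intro p hp q hq
        exact ⟨(⟨p, hp⟩ : C n) ⊗ₜ[K] (⟨q, hq⟩ : C n), rfl⟩
      obtain ⟨t, ht⟩ := h2 h1
      have h3 := Stmt14.lemA (Ψ ∘ₗ (C n).subtype) t (by
        intro v u
        have h4 := Stmt14.π_mul X hX3 π hπ w v u
        rw [hw0] at h4
        have h5 := congrArg (tensorBialgebraCounit K F) h4
        rw [LinearMap.zero_apply, map_zero] at h5
        rw [h5]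
        rw [AlgHom.toLinearMap_apply] at ht
        rw [← ht]
        clear ht h4 h5
        induction t with
        | zero => simp
        | add p q hp hq => simp only [map_add, hp, hq]
        | tmul p q => simp [hΨ])
      have hmem : ∀ z : LinearMap.ker (Ψ ∘ₗ (C n).subtype),
          ((z : C n) : TensorAlgebra K L) ∈ LinearMap.ker π.toLinearMap ⊓ C n :=
        fun z => ⟨hker _ z.2, z.1.2⟩
      have h6 := Submodule.mem_map_of_mem
        (f := TensorProduct.map (C n).subtype (C n).subtype) h3
      rw [ht, Submodule.map_sup, sup_comm] at h6
      revert h6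
      refine fun h6 => SetLike.le_def.1 (sup_le_sup ?_ ?_) h6
      · rintro _ ⟨_, ⟨s, rfl⟩, rfl⟩
        induction s with
        | zero => simp
        | add p q hp hq => simp only [map_add]; exact Submodule.add_mem _ hp hq
        | tmul p q =>
          exact ⟨(⟨_, hmem p⟩ : ↥(LinearMap.ker π.toLinearMap ⊓ C n)) ⊗ₜ[K]
            (q : TensorAlgebra K L), rfl⟩
      · rintro _ ⟨_, ⟨s, rfl⟩, rfl⟩
        induction s with
        | zero => simp
        | add p q hp hq => simp only [map_add]; exact Submodule.add_mem _ hp hq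
        | tmul p q =>
          exact ⟨(p : TensorAlgebra K L) ⊗ₜ[K]
            (⟨_, hmem q⟩ : ↥(LinearMap.ker π.toLinearMap ⊓ C n)), rfl⟩
    · have h1 := congrArg (tensorBialgebraCounit K F) (hcounit w)
      rw [hw0] at h1
      simpa using h1.symm
  · apply le_antisymm
    · intro a ha
      obtain ⟨n, hn⟩ := hC3 a
      exact Submodule.subset_span ⟨1, 1, a, ⟨n, ha, hn⟩, by simp⟩
    · rw [Submodule.span_le]
      rintro _ ⟨a, b, r, ⟨n, hr, _⟩, rfl⟩
      have hr0 : π r = 0 := hr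
      change π (a * r * b) = 0
      rw [map_mul π, map_mul π, hr0]
      simp
end
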